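/- (Proposition 3.2.) Assume (X,d) is a proper, geodesic, non-branching complete separable metric space, the Borel measure m satisfies the evolution estimate with rate f, and the restriction of m to the compact set K is a doubling measure. Let μ₀,μ₁ be Borel probability measures with supp(μ₀),supp(μ₁)⊂K and μ₀≪m. Define E:={x∈P₁(Γ) : Γ(x):=({x}×X)∩Γ is not a singleton} and Γ_E:=Γ∩(E×X). Then for every m-measurable selection T of Γ_E (i.e., T:P₁(Γ_E)→X m-measurable with graph(T)⊂Γ_E) and every coupling π of (μ₀,μ₁) with π(Γ)=1, one has π(Γ_E∖graph(T))=0. -/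

import Mathlib

open Set Metric MeasureTheory

/-- A geodesic parametrized on `[0,1]`: `d(γ_s,γ_t) = |s-t| · d(γ_0,γ_1)`. -/
def IsGeodesic {X : Type*} [MetricSpace X] (γ : ℝ → X) : Prop :=
  ∀ s ∈ Set.Icc (0:ℝ) 1, ∀ t ∈ Set.Icc (0:ℝ) 1,
    dist (γ s) (γ t) = |s - t| * dist (γ 0) (γ 1)

/-- A geodesic metric space: every pair of points is joined by a geodesic. -/
def GeodesicMetricSpace (X : Type*) [MetricSpace X] : Prop :=
  ∀ x y : X, ∃ γ : ℝ → X, IsGeodesic γ ∧ γ 0 = x ∧ γ 1 = y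

/-- Non-branching: two geodesics agreeing on `[0,t]` for some `t ∈ (0,1)` agree on `[0,1]`. -/
def NonBranching (X : Type*) [MetricSpace X] : Prop :=
  ∀ γ₁ γ₂ : ℝ → X, IsGeodesic γ₁ → IsGeodesic γ₂ →
    ∀ t ∈ Set.Ioo (0:ℝ) 1, (∀ s ∈ Set.Icc (0:ℝ) t, γ₁ s = γ₂ s) →
      ∀ s ∈ Set.Icc (0:ℝ) 1, γ₁ s = γ₂ s

/-- The evolution set `A_{t,Λ} = {γ_t : γ geodesic, γ_0 ∈ A, (γ_0,γ_1) ∈ Λ}`. -/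
def evoSet {X : Type*} [MetricSpace X] (A : Set X) (Λ : Set (X × X)) (t : ℝ) : Set X :=
  {z | ∃ γ : ℝ → X, IsGeodesic γ ∧ γ 0 ∈ A ∧ (γ 0, γ 1) ∈ Λ ∧ γ t = z}

/-- `m` satisfies the evolution estimate with rate `f` (a consequence of `MCP(K,N)`):
`f : [0,1] → [0,1]` is continuous, `f(0) = 1`, and `m(E_{t,E×{y}}) ≥ f(t)·m(E)` for every
compact `E`, every `y` and every `t ∈ [0,1]`. -/
def EvolutionEstimate {X : Type*} [MetricSpace X] [MeasurableSpace X]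
    (m : Measure X) (f : ℝ → ℝ) : Prop :=
  ContinuousOn f (Set.Icc 0 1) ∧ f 0 = 1 ∧
    (∀ t ∈ Set.Icc (0:ℝ) 1, f t ∈ Set.Icc (0:ℝ) 1) ∧
    ∀ E : Set X, IsCompact E → ∀ y : X, ∀ t ∈ Set.Icc (0:ℝ) 1,
      ENNReal.ofReal (f t) * m E ≤ m (evoSet E (E ×ˢ ({y} : Set X)) t)

/-- The contact set `Γ = {(x,y) ∈ K × K : φ(x) + φᶜ(y) = c(x,y)}`. -/
def contactSet {X : Type*} [MetricSpace X] (h : ℝ → ℝ) (φ φc : X → ℝ) (K : Set X) :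
    Set (X × X) :=
  {p | p.1 ∈ K ∧ p.2 ∈ K ∧ φ p.1 + φc p.2 = h (dist p.1 p.2)}

/-- `π` is a coupling of `(μ₀, μ₁)`: a probability measure on `X × X` with marginals
`μ₀` and `μ₁`. -/
def IsCoupling {X : Type*} [MeasurableSpace X] (π : Measure (X × X))
    (μ₀ μ₁ : Measure X) : Prop :=
  IsProbabilityMeasure π ∧ π.map Prod.fst = μ₀ ∧ π.map Prod.snd = μ₁

/-- `Γ_E = Γ ∩ (E × X)` where `E` is the set of `x` whose fiber `({x} × X) ∩ Γ` is
not a singleton. -/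
def branchSet {X : Type*} (Γ : Set (X × X)) : Set (X × X) :=
  {p ∈ Γ | ∃ w, w ≠ p.2 ∧ (p.1, w) ∈ Γ}

open Topology

/-- The points dividing a pair of `Λ` in the ratio `t : 1 - t`. -/
def interpolants {X : Type*} [MetricSpace X] (t : ℝ) (Λ : Set (X × X)) : Set X :=
  {z | ∃ p ∈ Λ, dist p.1 z = t * dist p.1 p.2 ∧ dist z p.2 = (1 - t) * dist p.1 p.2}

section Geodesics

variable {X : Type*} [MetricSpace X]

lemma interpolants_mono (t : ℝ) {Λ Λ' : Set (X × X)} (h : Λ ⊆ Λ') :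
    interpolants t Λ ⊆ interpolants t Λ' :=
  fun _ ⟨p, hp, hz⟩ => ⟨p, h hp, hz⟩

lemma evoSet_subset_interpolants {A : Set X} {Λ : Set (X × X)} {t : ℝ} (ht : t ∈ Icc (0 : ℝ) 1) :
    evoSet A Λ t ⊆ interpolants t Λ := by
  rintro z ⟨γ, hγ, -, hΛ, rfl⟩
  refine ⟨_, hΛ, ?_, ?_⟩
  · have := hγ 0 (by simp) t ht
    rwa [zero_sub, abs_neg, abs_of_nonneg ht.1] at this
  · have := hγ t ht 1 (by simp)
    rwa [abs_sub_comm, abs_of_nonneg (sub_nonneg.2 ht.2)] at this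

lemma isCompact_interpolants [ProperSpace X] (t : ℝ) {Λ : Set (X × X)} (hΛ : IsCompact Λ) :
    IsCompact (interpolants t Λ) := by
  refine isCompact_of_isClosed_isBounded ?_ ?_
  · have hcl : IsClosed {q : (X × X) × X | dist q.1.1 q.2 = t * dist q.1.1 q.1.2 ∧
        dist q.2 q.1.2 = (1 - t) * dist q.1.1 q.1.2} :=
      (isClosed_eq (by fun_prop) (by fun_prop)).inter (isClosed_eq (by fun_prop) (by fun_prop))
    have : CompactSpace Λ := isCompact_iff_compactSpace.1 hΛ
    have hcl' : IsClosed {q : Λ × X | dist q.1.1.1 q.2 = t * dist q.1.1.1 q.1.1.2 ∧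
        dist q.2 q.1.1.2 = (1 - t) * dist q.1.1.1 q.1.1.2} :=
      hcl.preimage (f := fun q : Λ × X => ((q.1 : X × X), q.2)) (by fun_prop)
    convert isClosedMap_snd_of_compactSpace _ hcl' using 1
    ext z
    simp [interpolants, and_left_comm]
  · obtain ⟨C, hC⟩ := (hΛ.image (f := fun p : X × X => dist p.1 p.2) (by fun_prop)).isBounded.bddAbove
    refine ((hΛ.image continuous_fst).isBounded.cthickening (δ := |t| * C)).subset ?_
    rintro z ⟨p, hp, hz, -⟩
    refine mem_cthickening_of_dist_le z p.1 _ _ (mem_image_of_mem _ hp) ?_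
    rw [dist_comm, hz]
    have := hC (mem_image_of_mem _ hp)
    calc t * dist p.1 p.2 ≤ |t| * dist p.1 p.2 := by gcongr; exact le_abs_self t
      _ ≤ |t| * C := by gcongr

/-- Gluing two geodesics whose lengths add up to the distance of the endpoints. -/
lemma IsGeodesic.glue {α β : ℝ → X} (hα : IsGeodesic α) (hβ : IsGeodesic β) {t : ℝ}
    (ht : t ∈ Ioo (0 : ℝ) 1) (hαβ : α 1 = β 0)
    (hα' : dist (α 0) (α 1) = t * dist (α 0) (β 1))
    (hβ' : dist (β 0) (β 1) = (1 - t) * dist (α 0) (β 1)) :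
    IsGeodesic (fun s => if s ≤ t then α (s / t) else β ((s - t) / (1 - t))) := by
  obtain ⟨ht0, ht1⟩ := ht
  have ht1' : 0 < 1 - t := by linarith
  set D := dist (α 0) (β 1) with hD
  have hα_dist : ∀ s ∈ Icc (0 : ℝ) t, ∀ r ∈ Icc (0 : ℝ) t, s ≤ r →
      dist (α (s / t)) (α (r / t)) = (r - s) * D := by
    intro s hs r hr hsr
    rw [hα (s / t) ⟨by have := hs.1; positivity, (div_le_one ht0).2 hs.2⟩ (r / t)
      ⟨by have := hr.1; positivity, (div_le_one ht0).2 hr.2⟩, hα', ← sub_div, abs_div,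
      abs_of_pos ht0, abs_sub_comm, abs_of_nonneg (sub_nonneg.2 hsr)]
    field_simp
  have hβ_mem : ∀ s ∈ Icc t 1, (s - t) / (1 - t) ∈ Icc (0 : ℝ) 1 := fun s hs =>
    ⟨div_nonneg (sub_nonneg.2 hs.1) ht1'.le, (div_le_one ht1').2 (by linarith [hs.2])⟩
  have hβ_dist : ∀ s ∈ Icc t 1, ∀ r ∈ Icc t 1, s ≤ r →
      dist (β ((s - t) / (1 - t))) (β ((r - t) / (1 - t))) = (r - s) * D := by
    intro s hs r hr hsr
    rw [hβ _ (hβ_mem s hs) _ (hβ_mem r hr), hβ', ← sub_div, abs_div,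
      abs_of_pos ht1', abs_sub_comm, abs_of_nonneg (by linarith)]
    field_simp
    ring
  set γ : ℝ → X := fun s => if s ≤ t then α (s / t) else β ((s - t) / (1 - t)) with hγ
  have hγ0 : γ 0 = α 0 := by simp [hγ, ht0.le]
  have hγ1 : γ 1 = β 1 := by simp [hγ, not_le.2 ht1, div_self ht1'.ne']
  have key : ∀ s ∈ Icc (0 : ℝ) 1, ∀ r ∈ Icc (0 : ℝ) 1, s ≤ r →
      dist (γ s) (γ r) = (r - s) * D := by
    intro s hs r hr hsr
    by_cases hst : s ≤ t <;> by_cases hrt : r ≤ t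
    · simpa [hγ, hst, hrt] using hα_dist s ⟨hs.1, hst⟩ r ⟨hr.1, hrt⟩ hsr
    · push Not at hrt
      have h1 := hα_dist s ⟨hs.1, hst⟩ t ⟨ht0.le, le_rfl⟩ hst
      have h2 := hβ_dist t ⟨le_rfl, ht1.le⟩ r ⟨hrt.le, hr.2⟩ hrt.le
      have h3 := hα_dist 0 ⟨le_rfl, ht0.le⟩ s ⟨hs.1, hst⟩ hs.1
      have h4 := hβ_dist r ⟨hrt.le, hr.2⟩ 1 ⟨ht1.le, le_rfl⟩ hr.2
      rw [div_self ht0.ne', hαβ] at h1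
      rw [sub_self, zero_div] at h2
      rw [zero_div] at h3
      rw [div_self ht1'.ne'] at h4
      simp only [hγ, hst, if_true, not_le.2 hrt, if_false]
      have h5 := dist_triangle (α (s / t)) (β 0) (β ((r - t) / (1 - t)))
      have h6 := dist_triangle4 (α 0) (α (s / t)) (β ((r - t) / (1 - t))) (β 1)
      apply le_antisymm <;> linarith
    · exact absurd (hsr.trans hrt) hst
    · push Not at hst hrt
      simpa [hγ, not_le.2 hst, not_le.2 hrt] using
        hβ_dist s ⟨hst.le, hs.2⟩ r ⟨hrt.le, hr.2⟩ hsr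
  intro s hs r hr
  rw [hγ0, hγ1]
  rcases le_total s r with hsr | hsr
  · rw [key s hs r hr hsr, abs_sub_comm, abs_of_nonneg (sub_nonneg.2 hsr)]
  · rw [dist_comm, key r hr s hs hsr, abs_of_nonneg (sub_nonneg.2 hsr)]

/-- In a non-branching geodesic space, two extensions of the same initial segment coincide. -/
lemma NonBranching.eq_of_dist_eq (hnb : NonBranching X) (hgeo : GeodesicMetricSpace X)
    {x z y y' : X} {t : ℝ} (ht : t ∈ Ioo (0 : ℝ) 1)
    (hxz : dist x z = t * dist x y) (hzy : dist z y = (1 - t) * dist x y)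
    (hxz' : dist x z = t * dist x y') (hzy' : dist z y' = (1 - t) * dist x y') : y = y' := by
  obtain ⟨α, hα, rfl, rfl⟩ := hgeo x z
  obtain ⟨β, hβ, hβ0, rfl⟩ := hgeo (α 1) y
  obtain ⟨β', hβ', hβ0', rfl⟩ := hgeo (α 1) y'
  have hγ := hα.glue hβ ht hβ0.symm hxz (by rw [hβ0, hzy])
  have hγ' := hα.glue hβ' ht hβ0'.symm hxz' (by rw [hβ0', hzy'])
  have := hnb _ _ hγ hγ' t ht (fun s hs => by simp [hs.2]) 1 (by simp)
  simpa [not_le.2 ht.2, div_self (sub_pos.2 ht.2).ne'] using this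

end Geodesics

section Cost

variable {h : ℝ → ℝ}

lemma StrictConvexOn.strictMonoOn_of_monotoneOn (hconv : StrictConvexOn ℝ (Ici (0 : ℝ)) h)
    (hmono : MonotoneOn h (Ici (0 : ℝ))) : StrictMonoOn h (Ici (0 : ℝ)) := by
  intro a ha b hb hab
  have ha' : 0 ≤ a := ha
  have hmid := hconv.2 ha hb hab.ne one_half_pos one_half_pos (add_halves 1)
  simp only [smul_eq_mul] at hmid
  have := hmono ha (show 1 / 2 * a + 1 / 2 * b ∈ Ici (0 : ℝ) from by
    simp only [mem_Ici] at *; linarith) (by linarith)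
  linarith

lemma ConvexOn.continuousOn_Ici_of_monotoneOn (hconv : ConvexOn ℝ (Ici (0 : ℝ)) h)
    (hmono : MonotoneOn h (Ici (0 : ℝ))) : ContinuousOn h (Ici (0 : ℝ)) := by
  intro a ha
  rcases (show (0 : ℝ) ≤ a from ha).eq_or_lt with rfl | ha
  · have hlim : Filter.Tendsto (fun x : ℝ => (1 - x) * h 0 + x * h 1) (𝓝[Ici 0] 0)
        (𝓝 (h 0)) := by
      have : Continuous fun x : ℝ => (1 - x) * h 0 + x * h 1 := by fun_prop
      simpa using (this.tendsto 0).mono_left nhdsWithin_le_nhds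
    refine tendsto_of_tendsto_of_tendsto_of_le_of_le' tendsto_const_nhds hlim ?_ ?_
    · filter_upwards [self_mem_nhdsWithin] with x hx
      exact hmono self_mem_Ici hx hx
    · filter_upwards [self_mem_nhdsWithin, nhdsWithin_le_nhds (Iio_mem_nhds one_pos)] with x hx hx1
      have := hconv.2 self_mem_Ici (zero_le_one' ℝ)
        (sub_nonneg.2 (le_of_lt hx1)) hx (by ring)
      simpa using this
  · have := hconv.continuousOn_interior
    rw [interior_Ici] at this
    exact (this.continuousAt (Ioi_mem_nhds ha)).continuousWithinAt

/-- Two cost-monotone transports through a common point at the same time have the same target. -/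
lemma eq_of_common_interpolant {X : Type*} [MetricSpace X]
    (hgeo : GeodesicMetricSpace X) (hnb : NonBranching X)
    (hconv : StrictConvexOn ℝ (Ici (0 : ℝ)) h) (hmono : MonotoneOn h (Ici (0 : ℝ)))
    {x y x' y' z : X} {t : ℝ} (ht : t ∈ Ioo (0 : ℝ) 1)
    (hcm : h (dist x y) + h (dist x' y') ≤ h (dist x y') + h (dist x' y))
    (hxz : dist x z = t * dist x y) (hzy : dist z y = (1 - t) * dist x y)
    (hxz' : dist x' z = t * dist x' y') (hzy' : dist z y' = (1 - t) * dist x' y') : y = y' := by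
  obtain ⟨ht0, ht1⟩ := ht
  have hs := hconv.strictMonoOn_of_monotoneOn hmono
  set a := dist x y with ha
  set b := dist x' y' with hb
  have ha0 : 0 ≤ a := dist_nonneg
  have hb0 : 0 ≤ b := dist_nonneg
  have ht1' : 0 < 1 - t := by linarith
  have h1 : dist x y' ≤ t * a + (1 - t) * b := by linarith [dist_triangle x z y']
  have h2 : dist x' y ≤ (1 - t) * a + t * b := by linarith [dist_triangle x' z y]
  have h1' := hmono (a := dist x y') dist_nonneg (by simp only [mem_Ici]; positivity) h1
  have h2' := hmono (a := dist x' y) dist_nonneg (by simp only [mem_Ici]; positivity) h2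
  have hab : a = b := by
    by_contra hne
    have h3 := hconv.2 ha0 hb0 hne ht0 ht1' (by ring)
    have h4 := hconv.2 ha0 hb0 hne ht1' ht0 (by ring)
    simp only [smul_eq_mul] at h3 h4
    linarith
  rw [← hab] at h1 h2 hcm hzy' hxz'
  have h5 : dist x y' = a := by
    by_contra hne
    have hlt : dist x y' < a := lt_of_le_of_ne (by linarith) hne
    have := hs (a := dist x y') dist_nonneg ha0 hlt
    have := hmono (a := dist x' y) dist_nonneg ha0 (by linarith)
    linarith
  exact hnb.eq_of_dist_eq hgeo ⟨ht0, ht1⟩ hxz hzy (by rw [h5, hxz]) (by rw [h5, hzy'])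

end Cost

section Transport

variable {X : Type*} [MetricSpace X] [ProperSpace X] [MeasurableSpace X] [BorelSpace X]
  {m : Measure X} {f h : ℝ → ℝ}

/-- The evolution estimate for transport to finitely many targets, each point of `A` being sent
to the targets minimizing `h (dist x y) - ψ y`. -/
lemma EvolutionEstimate.le_measure_interpolants_finset (hm : EvolutionEstimate m f)
    (hgeo : GeodesicMetricSpace X) (hnb : NonBranching X)
    (hconv : StrictConvexOn ℝ (Ici (0 : ℝ)) h) (hmono : MonotoneOn h (Ici (0 : ℝ)))
    (ψ : X → ℝ) {A : Set X} (hA : IsCompact A) (Y : Finset X) (hY : A.Nonempty → Y.Nonempty)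
    {t : ℝ} (ht : t ∈ Ioo (0 : ℝ) 1) :
    ENNReal.ofReal (f t) * m A ≤ m (interpolants t {p | p.1 ∈ A ∧ p.2 ∈ Y ∧
      ∀ w ∈ Y, h (dist p.1 p.2) - ψ p.2 ≤ h (dist p.1 w) - ψ w}) := by
  classical
  have hcont := hconv.convexOn.continuousOn_Ici_of_monotoneOn hmono
  have hcost : ∀ y, Continuous fun x : X => h (dist x y) := fun y =>
    hcont.comp_continuous (by fun_prop) fun x => dist_nonneg
  set S : X → Set X := fun y => {x ∈ A | ∀ w ∈ Y, h (dist x y) - ψ y ≤ h (dist x w) - ψ w}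
  have hScompact : ∀ y, IsCompact (S y) := fun y => by
    refine hA.inter_right (t := {x | ∀ w ∈ Y, h (dist x y) - ψ y ≤ h (dist x w) - ψ w}) ?_
    simp only [ofPred_forall]
    exact isClosed_biInter fun w _ =>
      isClosed_le ((hcost y).sub continuous_const) ((hcost w).sub continuous_const)
  have hcover : A ⊆ ⋃ y ∈ Y, S y := by
    intro x hx
    obtain ⟨y, hy, hmin⟩ := Y.exists_min_image (fun w => h (dist x w) - ψ w) (hY ⟨x, hx⟩)
    exact mem_iUnion₂.2 ⟨y, hy, hx, hmin⟩
  have hdisj : (Y : Set X).PairwiseDisjoint fun y => interpolants t (S y ×ˢ {y}) := by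
    intro y hy w hw hyw
    refine Set.disjoint_left.2 ?_
    rintro z ⟨⟨x, _⟩, ⟨hx, rfl⟩, h1, h2⟩ ⟨⟨x', _⟩, ⟨hx', rfl⟩, h3, h4⟩
    refine hyw (eq_of_common_interpolant hgeo hnb hconv hmono ht ?_ h1 h2 h3 h4)
    have := hx.2 _ hw
    have := hx'.2 _ hy
    dsimp only at *
    linarith
  calc ENNReal.ofReal (f t) * m A
      ≤ ENNReal.ofReal (f t) * ∑ y ∈ Y, m (S y) := by
        gcongr
        exact (measure_mono hcover).trans (measure_biUnion_finset_le _ _)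
    _ ≤ ∑ y ∈ Y, m (interpolants t (S y ×ˢ {y})) := by
        rw [Finset.mul_sum]
        refine Finset.sum_le_sum fun y _ => ?_
        exact (hm.2.2.2 _ (hScompact y) y t (Ioo_subset_Icc_self ht)).trans
          (measure_mono (evoSet_subset_interpolants (Ioo_subset_Icc_self ht)))
    _ = m (⋃ y ∈ Y, interpolants t (S y ×ˢ {y})) :=
        (measure_biUnion_finset hdisj fun y _ =>
          (isCompact_interpolants t ((hScompact y).prod isCompact_singleton)).measurableSet).symm
    _ ≤ _ := by
        refine measure_mono (iUnion₂_subset fun y hy => interpolants_mono t ?_)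
        rintro ⟨x, _⟩ ⟨hx, rfl⟩
        exact ⟨hx.1, hy, hx.2⟩

variable [IsFiniteMeasureOnCompacts m] {φ ψ : X → ℝ} {A B : Set X}

/-- The evolution estimate along the contact set of a pair of dual potentials. -/
lemma EvolutionEstimate.le_measure_interpolants (hm : EvolutionEstimate m f)
    (hgeo : GeodesicMetricSpace X) (hnb : NonBranching X)
    (hconv : StrictConvexOn ℝ (Ici (0 : ℝ)) h) (hmono : MonotoneOn h (Ici (0 : ℝ)))
    (hA : IsCompact A) (hB : IsCompact B) (hφ : ContinuousOn φ A) (hψ : ContinuousOn ψ B)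
    (hAB : ∀ x ∈ A, ∃ y ∈ B, h (dist x y) ≤ φ x + ψ y) {t : ℝ} (ht : t ∈ Ioo (0 : ℝ) 1) :
    ENNReal.ofReal (f t) * m A ≤
      m (interpolants t {p ∈ A ×ˢ B | h (dist p.1 p.2) ≤ φ p.1 + ψ p.2}) := by
  classical
  have hcont := hconv.convexOn.continuousOn_Ici_of_monotoneOn hmono
  have hcost : Continuous fun p : X × X => h (dist p.1 p.2) :=
    hcont.comp_continuous (by fun_prop) fun x => dist_nonneg
  set g : X × X → ℝ := fun p => h (dist p.1 p.2) - φ p.1 - ψ p.2 with hg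
  have hgcont : ContinuousOn g (A ×ˢ B) :=
    (hcost.continuousOn.sub (hφ.comp continuousOn_fst fun p hp => hp.1)).sub
      (hψ.comp continuousOn_snd fun p hp => hp.2)
  set L : ℕ → Set (X × X) := fun n => {p ∈ A ×ˢ B | g p ≤ 1 / ((n : ℝ) + 1)} with hL
  have hLcompact : ∀ n, IsCompact (L n) := fun n =>
    (hA.prod hB).of_isClosed_subset (hgcont.preimage_isClosed_of_isClosed
      (hA.prod hB).isClosed isClosed_Iic) inter_subset_left
  have hLanti : Antitone L := fun n k hnk p hp =>
    ⟨hp.1, hp.2.trans (Nat.one_div_le_one_div hnk)⟩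
  have hest : ∀ n, ENNReal.ofReal (f t) * m A ≤ m (interpolants t (L n)) := by
    intro n
    have hpos : (0 : ℝ) < 1 / ((n : ℝ) + 1) := Nat.one_div_pos_of_nat
    choose! T hTB hT using hAB
    obtain ⟨F, hFA, hFcover⟩ := hA.elim_nhdsWithin_subcover
      (fun x => {x' | g (x', T x) < 1 / ((n : ℝ) + 1)}) (fun x hx => by
        have hc : ContinuousWithinAt (fun x' => g (x', T x)) A x :=
          (hgcont (x, T x) ⟨hx, hTB x hx⟩).comp (f := fun x' => (x', T x))
            (by fun_prop) fun x' hx' => ⟨hx', hTB x hx⟩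
        refine hc.eventually_lt_const (lt_of_le_of_lt ?_ hpos)
        have := hT x hx
        simp only [hg]
        linarith)
    refine (hm.le_measure_interpolants_finset hgeo hnb hconv hmono ψ hA (F.image T) ?_ ht).trans
      (measure_mono (interpolants_mono t ?_))
    · rintro ⟨x, hx⟩
      obtain ⟨w, hw, -⟩ := mem_iUnion₂.1 (hFcover hx)
      exact ⟨T w, Finset.mem_image_of_mem T hw⟩
    · rintro ⟨x, y⟩ ⟨hx, hy, hmin⟩
      obtain ⟨v, hv, rfl⟩ := Finset.mem_image.1 hy
      obtain ⟨w, hw, hxw⟩ := mem_iUnion₂.1 (hFcover hx)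
      refine ⟨⟨hx, hTB v (hFA v hv)⟩, ?_⟩
      have h1 := hmin _ (Finset.mem_image_of_mem T hw)
      simp only [mem_ofPred_eq, hg] at hxw h1 ⊢
      linarith
  have hinter : ⋂ n, interpolants t (L n) ⊆
      interpolants t {p ∈ A ×ˢ B | h (dist p.1 p.2) ≤ φ p.1 + ψ p.2} := by
    intro z hz
    have hz' := mem_iInter.1 hz
    set M : ℕ → Set (X × X) := fun n => L n ∩
      {p | dist p.1 z = t * dist p.1 p.2 ∧ dist z p.2 = (1 - t) * dist p.1 p.2}
    have hcl : IsClosed {p : X × X | dist p.1 z = t * dist p.1 p.2 ∧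
        dist z p.2 = (1 - t) * dist p.1 p.2} :=
      (isClosed_eq (by fun_prop) (by fun_prop)).inter (isClosed_eq (by fun_prop) (by fun_prop))
    obtain ⟨p, hp⟩ := IsCompact.nonempty_iInter_of_sequence_nonempty_isCompact_isClosed M
      (fun n => inter_subset_inter_left _ (hLanti n.le_succ))
      (fun n => let ⟨p, hp, hpz⟩ := hz' n; ⟨p, hp, hpz⟩)
      ((hLcompact 0).inter_right hcl) (fun n => ((hLcompact n).inter_right hcl).isClosed)
    have hp' := mem_iInter.1 hp
    refine ⟨p, ⟨(hp' 0).1.1, ?_⟩, (hp' 0).2⟩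
    have : g p ≤ 0 := ge_of_tendsto' tendsto_one_div_add_atTop_nhds_zero_nat fun n => (hp' n).1.2
    simp only [hg] at this
    linarith
  refine le_trans ?_ (measure_mono hinter)
  rw [Antitone.measure_iInter (fun n k hnk => interpolants_mono t (hLanti hnk))
    (fun n => (isCompact_interpolants t (hLcompact n)).measurableSet.nullMeasurableSet)
    ⟨0, (isCompact_interpolants t (hLcompact 0)).measure_lt_top.ne⟩]
  exact le_iInf hest

/-- Points in contact with both of two disjoint compact target sets form a null set. -/
lemma EvolutionEstimate.measure_eq_zero_of_disjoint_targets (hm : EvolutionEstimate m f)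
    (hgeo : GeodesicMetricSpace X) (hnb : NonBranching X)
    (hconv : StrictConvexOn ℝ (Ici (0 : ℝ)) h) (hmono : MonotoneOn h (Ici (0 : ℝ)))
    {B' : Set X} (hA : IsCompact A) (hB : IsCompact B) (hB' : IsCompact B') (hBB' : Disjoint B B')
    (hφ : ContinuousOn φ A) (hψ : ContinuousOn ψ B) (hψ' : ContinuousOn ψ B')
    (hpot : ∀ x ∈ A, ∀ y ∈ B ∪ B', φ x + ψ y ≤ h (dist x y))
    (hAB : ∀ x ∈ A, ∃ y ∈ B, h (dist x y) ≤ φ x + ψ y)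
    (hAB' : ∀ x ∈ A, ∃ y ∈ B', h (dist x y) ≤ φ x + ψ y) : m A = 0 := by
  obtain ⟨R, hR⟩ : ∃ R : ℝ, ∀ x ∈ A, ∀ y ∈ B ∪ B', dist x y ≤ R := by
    obtain ⟨R, hR⟩ := isBounded_iff.1 (hA.union (hB.union hB')).isBounded
    exact ⟨R, fun x hx y hy => hR (Or.inl hx) (Or.inr hy)⟩
  have hest : ∀ t ∈ Ioo (0 : ℝ) 1,
      ENNReal.ofReal (f t) * m A + ENNReal.ofReal (f t) * m A ≤ m (cthickening (t * R) A) := by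
    intro t ht
    set I := interpolants t {p ∈ A ×ˢ B | h (dist p.1 p.2) ≤ φ p.1 + ψ p.2}
    set I' := interpolants t {p ∈ A ×ˢ B' | h (dist p.1 p.2) ≤ φ p.1 + ψ p.2}
    have hthick : ∀ C ⊆ B ∪ B', interpolants t {p ∈ A ×ˢ C | h (dist p.1 p.2) ≤ φ p.1 + ψ p.2} ⊆
        cthickening (t * R) A := by
      rintro C hC z ⟨p, ⟨hp, -⟩, hz, -⟩
      refine mem_cthickening_of_dist_le z p.1 _ _ hp.1 ?_
      rw [dist_comm, hz]
      have := ht.1.le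
      gcongr
      exact hR _ hp.1 _ (hC hp.2)
    have hdisj : Disjoint I I' := by
      refine Set.disjoint_left.2 ?_
      rintro z ⟨p, ⟨hp, hpc⟩, h1, h2⟩ ⟨q, ⟨hq, hqc⟩, h3, h4⟩
      refine Set.disjoint_left.1 hBB' hp.2 ?_
      rw [eq_of_common_interpolant hgeo hnb hconv hmono ht ?_ h1 h2 h3 h4]
      · exact hq.2
      · have := hpot _ hp.1 _ (Or.inr hq.2)
        have := hpot _ hq.1 _ (Or.inl hp.2)
        linarith
    have hI' : MeasurableSet I' := by
      refine (isCompact_interpolants t ((hA.prod hB').of_isClosed_subset ?_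
        inter_subset_left)).measurableSet
      have hcost : Continuous fun p : X × X => h (dist p.1 p.2) :=
        (hconv.convexOn.continuousOn_Ici_of_monotoneOn hmono).comp_continuous (by fun_prop)
          fun x => dist_nonneg
      exact (hA.prod hB').isClosed.isClosed_le hcost.continuousOn
        ((hφ.comp continuousOn_fst fun p hp => hp.1).add
          (hψ'.comp continuousOn_snd fun p hp => hp.2))
    calc ENNReal.ofReal (f t) * m A + ENNReal.ofReal (f t) * m A ≤ m I + m I' :=
          add_le_add (hm.le_measure_interpolants hgeo hnb hconv hmono hA hB hφ hψ hAB ht)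
            (hm.le_measure_interpolants hgeo hnb hconv hmono hA hB' hφ hψ' hAB' ht)
      _ = m (I ∪ I') := (measure_union hdisj hI').symm
      _ ≤ _ := measure_mono (union_subset (hthick B subset_union_left)
          (hthick B' subset_union_right))
  have hIoo : Ioo (0 : ℝ) 1 ∈ 𝓝[>] (0 : ℝ) := Ioo_mem_nhdsGT one_pos
  have hf : Filter.Tendsto (fun t => ENNReal.ofReal (f t)) (𝓝[>] 0) (𝓝 1) := by
    have h0 : Filter.Tendsto f (𝓝[>] 0) (𝓝 1) := by
      have := (hm.1 0 (by simp)).tendsto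
      rw [hm.2.1] at this
      exact this.mono_left (nhdsWithin_le_of_mem (Filter.mem_of_superset hIoo Ioo_subset_Icc_self))
    simpa using ENNReal.tendsto_ofReal h0
  have hleft : Filter.Tendsto (fun t => ENNReal.ofReal (f t) * m A + ENNReal.ofReal (f t) * m A)
      (𝓝[>] 0) (𝓝 (m A + m A)) := by
    have := ENNReal.Tendsto.mul_const (b := m A) hf (Or.inl one_ne_zero)
    rw [one_mul] at this
    exact this.add this
  have hright : Filter.Tendsto (fun t : ℝ => m (cthickening (t * R) A)) (𝓝[>] 0) (𝓝 (m A)) := by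
    refine (tendsto_measure_cthickening_of_isCompact hA).comp ?_
    have : Continuous fun t : ℝ => t * R := by fun_prop
    simpa using (this.tendsto 0).mono_left nhdsWithin_le_nhds
  have hle : m A + m A ≤ m A := le_of_tendsto_of_tendsto hleft hright
    (by filter_upwards [hIoo] with t ht using hest t ht)
  have hfin : m A ≠ ⊤ := hA.measure_lt_top.ne
  by_contra h0
  exact absurd hle (not_le.2 (ENNReal.lt_add_right hfin h0))

end Transport

theorem selection_full_measure_on_branch_set
    {X : Type*} [MetricSpace X] [ProperSpace X] [CompleteSpace X]
    [TopologicalSpace.SeparableSpace X] [MeasurableSpace X] [BorelSpace X]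
    (hgeo : GeodesicMetricSpace X) (hnb : NonBranching X)
    (m : Measure X) [IsFiniteMeasureOnCompacts m]
    (f : ℝ → ℝ) (hm : EvolutionEstimate m f)
    (h : ℝ → ℝ) (hconv : StrictConvexOn ℝ (Set.Ici (0:ℝ)) h)
    (hmono : MonotoneOn h (Set.Ici (0:ℝ))) (hpos : ∀ x ∈ Set.Ici (0:ℝ), 0 ≤ h x)
    (K : Set X) (hK : IsCompact K)
    (hdoub : ∃ C : ENNReal, ∀ x ∈ K, ∀ r : ℝ, 0 < r →
      (m.restrict K) (Metric.closedBall x (2 * r)) ≤ C * (m.restrict K) (Metric.closedBall x r))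
    (φ φc : X → ℝ) (hφ : ContinuousOn φ K) (hφc : ContinuousOn φc K)
    (hpot : ∀ x ∈ K, ∀ y ∈ K, φ x + φc y ≤ h (dist x y))
    (μ₀ μ₁ : Measure X) [IsProbabilityMeasure μ₀] [IsProbabilityMeasure μ₁]
    (hsupp₀ : μ₀ Kᶜ = 0) (hsupp₁ : μ₁ Kᶜ = 0) (hac : μ₀ ≪ m)
    (T : X → X) (hTmeas : AEMeasurable T m)
    (hTsel : ∀ x ∈ Prod.fst '' branchSet (contactSet h φ φc K),
      (x, T x) ∈ branchSet (contactSet h φ φc K))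
    (π : Measure (X × X)) (hπ : IsCoupling π μ₀ μ₁)
    (hπΓ : π (contactSet h φ φc K) = 1) :
    π (branchSet (contactSet h φ φc K) \ {p | p.2 = T p.1}) = 0 := by
  have hcost : Continuous fun p : X × X => h (dist p.1 p.2) :=
    (hconv.convexOn.continuousOn_Ici_of_monotoneOn hmono).comp_continuous (by fun_prop)
      fun x => dist_nonneg
  have hΓ : IsCompact (contactSet h φ φc K) := by
    have : contactSet h φ φc K = {p ∈ K ×ˢ K | h (dist p.1 p.2) ≤ φ p.1 + φc p.2} := by
      ext p
      exact ⟨fun hp => ⟨⟨hp.1, hp.2.1⟩, hp.2.2.ge⟩,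
        fun hp => ⟨hp.1.1, hp.1.2, le_antisymm (hpot _ hp.1.1 _ hp.1.2) hp.2⟩⟩
    rw [this]
    refine (hK.prod hK).of_isClosed_subset ?_ inter_subset_left
    exact (hK.prod hK).isClosed.isClosed_le hcost.continuousOn
      ((hφ.comp continuousOn_fst fun p hp => hp.1).add
        (hφc.comp continuousOn_snd fun p hp => hp.2))
  obtain ⟨D, hDcount, hDdense⟩ := TopologicalSpace.exists_countable_dense X
  have : Countable D := hDcount.to_subtype
  let N : D × ℚ × ℚ → Set X := fun i =>
    Prod.fst '' (contactSet h φ φc K ∩ {p | dist p.2 i.1 ≤ (i.2.1 : ℝ)}) ∩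
      Prod.fst '' (contactSet h φ φc K ∩ {p | (i.2.2 : ℝ) ≤ dist p.2 i.1})
  have hN : ∀ i : D × ℚ × ℚ, i.2.1 < i.2.2 → m (N i) = 0 := by
    intro i hi
    have hcl : IsClosed {y : X | dist y i.1 ≤ (i.2.1 : ℝ)} :=
      isClosed_le (by fun_prop) (by fun_prop)
    have hcl' : IsClosed {y : X | (i.2.2 : ℝ) ≤ dist y i.1} :=
      isClosed_le (by fun_prop) (by fun_prop)
    have hNK : N i ⊆ K := by
      rintro _ ⟨⟨p, hp, rfl⟩, -⟩
      exact hp.1.1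
    refine hm.measure_eq_zero_of_disjoint_targets hgeo hnb hconv hmono (A := N i) ?_
      (hK.inter_right hcl) (hK.inter_right hcl') ?_ (hφ.mono hNK)
      (hφc.mono inter_subset_left) (hφc.mono inter_subset_left) ?_ ?_ ?_
    · exact ((hΓ.inter_right (hcl.preimage continuous_snd)).image continuous_fst).inter
        ((hΓ.inter_right (hcl'.preimage continuous_snd)).image continuous_fst)
    · refine Set.disjoint_left.2 fun y hy hy' => ?_
      have h1 : (i.2.1 : ℝ) < i.2.2 := by exact_mod_cast hi
      exact absurd ((show (i.2.2 : ℝ) ≤ dist y i.1 from hy'.2).trans hy.2) (not_le.2 h1)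
    · rintro x hx y (hy | hy) <;> exact hpot x (hNK hx) y hy.1
    · rintro _ ⟨⟨p, hp, rfl⟩, -⟩
      exact ⟨p.2, ⟨hp.1.2.1, hp.2⟩, hp.1.2.2.ge⟩
    · rintro _ ⟨-, ⟨p, hp, rfl⟩⟩
      exact ⟨p.2, ⟨hp.1.2.1, hp.2⟩, hp.1.2.2.ge⟩
  set E := ⋃ i : {i : D × ℚ × ℚ // i.2.1 < i.2.2}, N i
  have hE : μ₀ E = 0 := hac (measure_iUnion_null fun i => hN i i.2)
  refine measure_mono_null (t := Prod.fst ⁻¹' E) ?_ ?_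
  · rintro p ⟨⟨hp, w, hw, hpw⟩, -⟩
    have hd : 0 < dist w p.2 := dist_pos.2 hw
    obtain ⟨u, huD, hu⟩ := hDdense.exists_dist_lt p.2 (half_pos hd)
    have hu' : dist p.2 u < dist w u := by
      linarith [dist_triangle w u p.2, dist_comm u p.2]
    obtain ⟨q, hq, hq'⟩ := exists_rat_btwn hu'
    obtain ⟨r, hr, hr'⟩ := exists_rat_btwn hq'
    exact mem_iUnion.2 ⟨⟨(⟨u, huD⟩, q, r), by exact_mod_cast hr⟩,
      ⟨p, ⟨hp, hq.le⟩, rfl⟩, ⟨(p.1, w), ⟨hpw, hr'.le⟩, rfl⟩⟩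
  · refine le_antisymm ((Measure.le_map_apply measurable_fst.aemeasurable E).trans ?_) zero_le
    rw [hπ.2.1, hE]
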